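/- For every m ∈ ℕ, the polytope P_III^(m) equals the set of α ∈ ℝ^{2m+6} satisfying Σ_{i=0}^{2m+5} α_i = m+1 together with: (i) α_i + α_j ≤ 0 for 0 ≤ i < j ≤ 2; (ii) −α_i ≤ α_0 + α_1 + α_2 for 3 ≤ i ≤ 2m+5; (iii) α_i − 1 ≤ α_0 + α_1 + α_2 for 3 ≤ i ≤ 2m+5. -/

import Mathlib

noncomputable section

open Finset

/-- Standard basis vector `e i` of `ℝ^(2m+6)`. -/
def e (m : ℕ) (i : Fin (2 * m + 6)) : Fin (2 * m + 6) → ℝ := fun k => if k = i then 1 else 0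

/-- The vector `ρ = (1/2, …, 1/2)` in `ℝ^(2m+6)`. -/
def ρ (m : ℕ) : Fin (2 * m + 6) → ℝ := fun _ => 1 / 2

/-- The vector `v_S = ∑_{j ∈ S} e_j`. -/
def vS (m : ℕ) (S : Finset (Fin (2 * m + 6))) : Fin (2 * m + 6) → ℝ := ∑ j ∈ S, e m j

/-- The vector `w_{ij} = ρ - e_i - e_j`. -/
def w (m : ℕ) (i j : Fin (2 * m + 6)) : Fin (2 * m + 6) → ℝ := ρ m - e m i - e m j

/-- The polytope `P^(m)`, convex hull of all `v_S` (`|S| = m+1`) and all `w_{ij}` (`i < j`). -/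
def P (m : ℕ) : Set (Fin (2 * m + 6) → ℝ) :=
  convexHull ℝ
    ({x | ∃ S : Finset (Fin (2 * m + 6)), S.card = m + 1 ∧ x = vS m S} ∪
      {x | ∃ i j : Fin (2 * m + 6), i < j ∧ x = w m i j})

/-- The polytope `P_I^(m)`, convex hull of all `v_S` with `|S| = m+1`. -/
def PI (m : ℕ) : Set (Fin (2 * m + 6) → ℝ) :=
  convexHull ℝ {x | ∃ S : Finset (Fin (2 * m + 6)), S.card = m + 1 ∧ x = vS m S}

/-- The polytope `P_II^(m)`, convex hull of the `v_S` with `S ⊆ {1,…,2m+5}`, `|S| = m+1`,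
together with the `w_{0j}` for `1 ≤ j ≤ 2m+5`. -/
def PII (m : ℕ) : Set (Fin (2 * m + 6) → ℝ) :=
  convexHull ℝ
    ({x | ∃ S : Finset (Fin (2 * m + 6)), S.card = m + 1 ∧ (0 : Fin (2 * m + 6)) ∉ S ∧ x = vS m S} ∪
      {x | ∃ j : Fin (2 * m + 6), j ≠ 0 ∧ x = w m 0 j})

/-- The polytope `P_III^(m)`, convex hull of the `v_S` with `S ⊆ {3,…,2m+5}`, `|S| = m+1`,
together with the `w_{ij}` for `0 ≤ i < j ≤ 2`. -/
def PIII (m : ℕ) : Set (Fin (2 * m + 6) → ℝ) :=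
  convexHull ℝ
    ({x | ∃ S : Finset (Fin (2 * m + 6)), S.card = m + 1 ∧ (∀ s ∈ S, 3 ≤ (s : ℕ)) ∧ x = vS m S} ∪
      {x | ∃ i j : Fin (2 * m + 6), (i : ℕ) < (j : ℕ) ∧ (j : ℕ) ≤ 2 ∧ x = w m i j})
/-- The hypersimplex of level `k` on the face of the cube `[0,1]^ι` spanned by `T`. -/
def hypersimplexOn {ι : Type*} [Fintype ι] (T : Finset ι) (k : ℕ) : Set (ι → ℝ) :=
  {x | (∀ i, 0 ≤ x i ∧ x i ≤ 1) ∧ (∀ i ∉ T, x i = 0) ∧ ∑ i, x i = k}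

theorem convex_hypersimplexOn {ι : Type*} [Fintype ι] (T : Finset ι) (k : ℕ) :
    Convex ℝ (hypersimplexOn T k) := by
  rintro x ⟨hx, hxT, hxs⟩ y ⟨hy, hyT, hys⟩ a b ha hb hab
  refine ⟨fun i => ?_, fun i hi => by simp [hxT i hi, hyT i hi], ?_⟩
  · simp only [Pi.add_apply, Pi.smul_apply, smul_eq_mul]
    constructor
    · have := mul_nonneg ha (hx i).1
      have := mul_nonneg hb (hy i).1
      linarith
    · have := mul_le_mul_of_nonneg_left (hx i).2 ha
      have := mul_le_mul_of_nonneg_left (hy i).2 hb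
      linarith
  · simp only [Pi.add_apply, Pi.smul_apply, smul_eq_mul, sum_add_distrib, ← mul_sum, hxs, hys]
    rw [← add_mul, hab, one_mul]

theorem isCompact_hypersimplexOn {ι : Type*} [Fintype ι] (T : Finset ι) (k : ℕ) :
    IsCompact (hypersimplexOn T k) := by
  refine (isCompact_univ_pi fun _ : ι => isCompact_Icc (a := (0 : ℝ)) (b := 1)).of_isClosed_subset
    ?_ fun x hx i _ => hx.1 i
  have h : hypersimplexOn T k = (⋂ i, {x : ι → ℝ | 0 ≤ x i ∧ x i ≤ 1}) ∩
      ((⋂ i, ⋂ (_ : i ∉ T), {x : ι → ℝ | x i = 0}) ∩ {x | ∑ i, x i = k}) := by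
    ext x
    simp [hypersimplexOn]
  rw [h]
  refine (isClosed_iInter fun i => ?_).inter
    ((isClosed_iInter fun i => isClosed_iInter fun _ => ?_).inter ?_)
  · exact (isClosed_le continuous_const (continuous_apply i)).inter
      (isClosed_le (continuous_apply i) continuous_const)
  · exact isClosed_eq (continuous_apply i) continuous_const
  · exact isClosed_eq (by fun_prop) continuous_const

/-- A point of a hypersimplex with one fractional coordinate has another one. -/
theorem exists_ne_fractional {ι : Type*} [Fintype ι] {T : Finset ι} {k : ℕ} {x : ι → ℝ}
    (hx : x ∈ hypersimplexOn T k) {i : ι} (h0 : 0 < x i) (h1 : x i < 1) :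
    ∃ j ≠ i, 0 < x j ∧ x j < 1 := by
  classical
  by_contra! h
  have hj : ∀ j ∈ univ.erase i, x j = if x j = 1 then 1 else 0 := by
    intro j hj
    split_ifs with hj1
    · exact hj1
    · by_contra hj0
      exact hj1 (le_antisymm (hx.1 j).2
        (h j (ne_of_mem_erase hj) (lt_of_le_of_ne (hx.1 j).1 (Ne.symm hj0))))
  have hs := hx.2.2
  rw [← add_sum_erase _ _ (mem_univ i), sum_congr rfl hj, sum_boole] at hs
  set c := ((univ.erase i).filter fun j => x j = 1).card
  have hlt : c < k := by exact_mod_cast (by linarith : (c : ℝ) < k)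
  have hgt : k < c + 1 := by exact_mod_cast (by linarith : (k : ℝ) < c + 1)
  omega

/-- Moving mass between two coordinates with enough room stays in the hypersimplex. -/
theorem add_transfer_mem_hypersimplexOn {ι : Type*} [Fintype ι] [DecidableEq ι] {T : Finset ι}
    {k : ℕ} {x : ι → ℝ} (hx : x ∈ hypersimplexOn T k) {i j : ι} (hij : i ≠ j) (hi : i ∈ T)
    (hj : j ∈ T) {c : ℝ} (hi0 : 0 ≤ x i + c) (hi1 : x i + c ≤ 1) (hj0 : 0 ≤ x j - c)
    (hj1 : x j - c ≤ 1) :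
    x + (Pi.single i c - Pi.single j c) ∈ hypersimplexOn T k := by
  refine ⟨fun l => ?_, fun l hl => ?_, ?_⟩
  · rcases eq_or_ne l i with rfl | hli
    · simpa [hij] using And.intro hi0 hi1
    · rcases eq_or_ne l j with rfl | hlj
      · simpa [hli, ← sub_eq_add_neg] using And.intro hj0 hj1
      · simpa [hli, hlj] using hx.1 l
  · have hli : l ≠ i := fun h => hl (h ▸ hi)
    have hlj : l ≠ j := fun h => hl (h ▸ hj)
    simp [hli, hlj, hx.2.1 l hl]
  · simp [sum_add_distrib, hx.2.2]

theorem extremePoints_hypersimplexOn_integral {ι : Type*} [Fintype ι] {T : Finset ι} {k : ℕ}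
    {x : ι → ℝ} (hx : x ∈ (hypersimplexOn T k).extremePoints ℝ) (i : ι) : x i = 0 ∨ x i = 1 := by
  classical
  rw [mem_extremePoints] at hx
  obtain ⟨hxm, hext⟩ := hx
  by_contra! h
  have hi0 : 0 < x i := lt_of_le_of_ne (hxm.1 i).1 h.1.symm
  have hi1 : x i < 1 := lt_of_le_of_ne (hxm.1 i).2 h.2
  obtain ⟨j, hji, hj0, hj1⟩ := exists_ne_fractional hxm hi0 hi1
  have hiT : i ∈ T := by
    by_contra hi
    exact h.1 (hxm.2.1 i hi)
  have hjT : j ∈ T := by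
    by_contra hj
    exact hj0.ne' (hxm.2.1 j hj)
  obtain ⟨c, hc, hc'⟩ : ∃ c > 0, c ≤ x i ∧ c ≤ 1 - x i ∧ c ≤ x j ∧ c ≤ 1 - x j :=
    ⟨min (min (x i) (1 - x i)) (min (x j) (1 - x j)), by
      simp only [gt_iff_lt, lt_min_iff, sub_pos]; exact ⟨⟨hi0, hi1⟩, hj0, hj1⟩, by simp⟩
  obtain ⟨h1, h2, h3, h4⟩ := hc'
  have hp := add_transfer_mem_hypersimplexOn hxm hji.symm hiT hjT (c := c)
    (by linarith) (by linarith) (by linarith) (by linarith)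
  have hn := add_transfer_mem_hypersimplexOn hxm hji.symm hiT hjT (c := -c)
    (by linarith) (by linarith) (by linarith) (by linarith)
  have heq := (hext _ hp _ hn ⟨1 / 2, 1 / 2, by norm_num, by norm_num, by norm_num, by
    ext l
    simp only [Pi.add_apply, Pi.smul_apply, Pi.sub_apply, Pi.single_neg, Pi.neg_apply, smul_eq_mul]
    ring⟩).1
  have := congrFun heq i
  simp [hji.symm] at this
  exact hc.ne' this

/-- The hypersimplex is the convex hull of the indicator vectors of its `k`-subsets. -/
theorem hypersimplexOn_subset_convexHull {ι : Type*} [Fintype ι] [DecidableEq ι] (T : Finset ι)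
    (k : ℕ) : hypersimplexOn T k ⊆ convexHull ℝ
      {x | ∃ S ⊆ T, S.card = k ∧ x = fun i => if i ∈ S then (1 : ℝ) else 0} := by
  rw [← closure_convexHull_extremePoints (isCompact_hypersimplexOn T k)
    (convex_hypersimplexOn T k)]
  have hfin : {x : ι → ℝ | ∃ S ⊆ T, S.card = k ∧
      x = fun i => if i ∈ S then (1 : ℝ) else 0}.Finite :=
    (Set.finite_range fun S : Finset ι => fun i => if i ∈ S then (1 : ℝ) else 0).subset
      fun x ⟨S, _, _, hS⟩ => ⟨S, hS.symm⟩
  refine closure_minimal (convexHull_mono fun x hx => ?_) (hfin.isClosed_convexHull ℝ)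
  have hint := extremePoints_hypersimplexOn_integral hx
  have hxm := extremePoints_subset hx
  have hval : ∀ i, x i = if x i = 1 then 1 else 0 := fun i => by
    rcases hint i with h | h <;> simp [h]
  refine ⟨univ.filter fun i => x i = 1, fun i hi => ?_, ?_, ?_⟩
  · by_contra hiT
    simp [hxm.2.1 i hiT] at hi
  · have hs := hxm.2.2
    rw [sum_congr rfl fun i _ => hval i, sum_boole] at hs
    exact_mod_cast hs
  · ext i
    simpa using hval i

theorem vS_apply (m : ℕ) (S : Finset (Fin (2 * m + 6))) (k : Fin (2 * m + 6)) :
    vS m S k = if k ∈ S then 1 else 0 := by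
  simp [vS, e]

theorem w_apply (m : ℕ) (i j k : Fin (2 * m + 6)) :
    w m i j k = 1 / 2 - (if k = i then 1 else 0) - (if k = j then 1 else 0) := by
  simp [w, ρ, e]

theorem sum_vS (m : ℕ) (S : Finset (Fin (2 * m + 6))) : ∑ k, vS m S k = S.card := by
  simp [vS_apply]

theorem sum_w (m : ℕ) (i j : Fin (2 * m + 6)) : ∑ k, w m i j k = (m : ℝ) + 1 := by
  simp only [w_apply, sum_sub_distrib, sum_const, card_univ, Fintype.card_fin, nsmul_eq_mul,
    sum_ite_eq', mem_univ, if_true]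
  push_cast
  ring

theorem val_two (m : ℕ) : ((2 : Fin (2 * m + 6)) : ℕ) = 2 :=
  Nat.mod_eq_of_lt (show 2 < 2 * m + 6 by omega)

theorem val_one_eq (m : ℕ) : ((1 : Fin (2 * m + 6)) : ℕ) = 1 :=
  Nat.mod_eq_of_lt (show 1 < 2 * m + 6 by omega)

/-- The pairs `i < j ≤ 2` are `(0,1)`, `(0,2)` and `(1,2)`. -/
theorem pair_cases (m : ℕ) {i j : Fin (2 * m + 6)} (hij : (i : ℕ) < j) (hj : (j : ℕ) ≤ 2) :
    (i = 0 ∧ j = 1) ∨ (i = 0 ∧ j = 2) ∨ (i = 1 ∧ j = 2) := by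
  simp only [Fin.ext_iff, Fin.val_zero, val_one_eq, val_two]
  omega

/-- The set cut out by the defining inequalities of `P_III^(m)`. -/
def PIIIPolyhedron (m : ℕ) : Set (Fin (2 * m + 6) → ℝ) :=
  {α | (∑ i, α i) = (m : ℝ) + 1 ∧
    (∀ i j : Fin (2 * m + 6), (i : ℕ) < (j : ℕ) → (j : ℕ) ≤ 2 → α i + α j ≤ 0) ∧
    (∀ i : Fin (2 * m + 6), 3 ≤ (i : ℕ) → -α i ≤ α 0 + α 1 + α 2) ∧
    (∀ i : Fin (2 * m + 6), 3 ≤ (i : ℕ) → α i - 1 ≤ α 0 + α 1 + α 2)}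

theorem convex_PIIIPolyhedron (m : ℕ) : Convex ℝ (PIIIPolyhedron m) := by
  rintro x ⟨hx, hx1, hx2, hx3⟩ y ⟨hy, hy1, hy2, hy3⟩ a b ha hb hab
  refine ⟨?_, fun i j hij hj => ?_, fun i hi => ?_, fun i hi => ?_⟩ <;>
    simp only [Pi.add_apply, Pi.smul_apply, smul_eq_mul]
  · rw [sum_add_distrib, ← mul_sum, ← mul_sum, hx, hy, ← add_mul, hab, one_mul]
  · have := mul_le_mul_of_nonneg_left (hx1 i j hij hj) ha
    have := mul_le_mul_of_nonneg_left (hy1 i j hij hj) hb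
    linarith
  · have := mul_le_mul_of_nonneg_left (hx2 i hi) ha
    have := mul_le_mul_of_nonneg_left (hy2 i hi) hb
    linarith
  · have := mul_le_mul_of_nonneg_left (hx3 i hi) ha
    have := mul_le_mul_of_nonneg_left (hy3 i hi) hb
    linarith

theorem vS_mem_PIIIPolyhedron (m : ℕ) {S : Finset (Fin (2 * m + 6))} (hS : S.card = m + 1)
    (hS3 : ∀ s ∈ S, 3 ≤ (s : ℕ)) : vS m S ∈ PIIIPolyhedron m := by
  have hlow : ∀ k : Fin (2 * m + 6), (k : ℕ) ≤ 2 → vS m S k = 0 := fun k hk => by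
    rw [vS_apply, if_neg fun h => by have := hS3 k h; omega]
  have h0 := hlow 0 (by simp)
  have h1 := hlow 1 (by rw [val_one_eq]; norm_num)
  have h2 := hlow 2 (by rw [val_two])
  refine ⟨by rw [sum_vS, hS]; push_cast; rfl, fun i j hij hj => ?_, fun i _ => ?_, fun i _ => ?_⟩
  · rw [hlow i (by omega), hlow j hj, add_zero]
  · rw [h0, h1, h2, vS_apply]
    split_ifs <;> norm_num
  · rw [h0, h1, h2, vS_apply]
    split_ifs <;> norm_num

theorem fin_distinct (m : ℕ) :
    (0 : Fin (2 * m + 6)) ≠ 1 ∧ (0 : Fin (2 * m + 6)) ≠ 2 ∧ (1 : Fin (2 * m + 6)) ≠ 2 := by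
  simp only [ne_eq, Fin.ext_iff, Fin.val_zero, val_one_eq, val_two]
  omega

/-- The value of `w_{ij}`, for `i < j ≤ 2`, at a coordinate outside `{0,1,2}`. -/
theorem w_apply_of_three_le (m : ℕ) {i j k : Fin (2 * m + 6)} (hij : (i : ℕ) < j)
    (hj : (j : ℕ) ≤ 2) (hk : 3 ≤ (k : ℕ)) : w m i j k = 1 / 2 := by
  have hki : k ≠ i := by rintro rfl; omega
  have hkj : k ≠ j := by rintro rfl; omega
  simp [w_apply, hki, hkj]

theorem w_mem_PIIIPolyhedron (m : ℕ) {i j : Fin (2 * m + 6)} (hij : (i : ℕ) < j)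
    (hj : (j : ℕ) ≤ 2) : w m i j ∈ PIIIPolyhedron m := by
  obtain ⟨h01, h02, h12⟩ := fin_distinct m
  have hs : w m i j 0 + w m i j 1 + w m i j 2 = -1 / 2 := by
    rcases pair_cases m hij hj with ⟨rfl, rfl⟩ | ⟨rfl, rfl⟩ | ⟨rfl, rfl⟩ <;>
      simp only [w_apply, h01, h02, h12, h01.symm, h02.symm, h12.symm, if_true, if_false] <;>
      norm_num
  refine ⟨sum_w m i j, fun a b hab hb => ?_, fun k hk => ?_, fun k hk => ?_⟩
  · rcases pair_cases m hij hj with ⟨rfl, rfl⟩ | ⟨rfl, rfl⟩ | ⟨rfl, rfl⟩ <;>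
      rcases pair_cases m hab hb with ⟨rfl, rfl⟩ | ⟨rfl, rfl⟩ | ⟨rfl, rfl⟩ <;>
      simp only [w_apply, h01, h02, h12, h01.symm, h02.symm, h12.symm, if_true, if_false] <;>
      norm_num
  · rw [hs, w_apply_of_three_le m hij hj hk]
    norm_num
  · rw [hs, w_apply_of_three_le m hij hj hk]
    norm_num

theorem PIII_subset_PIIIPolyhedron (m : ℕ) : PIII m ⊆ PIIIPolyhedron m := by
  refine convexHull_min ?_ (convex_PIIIPolyhedron m)
  rintro x (⟨S, hS, hS3, rfl⟩ | ⟨i, j, hij, hj, rfl⟩)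
  · exact vS_mem_PIIIPolyhedron m hS hS3
  · exact w_mem_PIIIPolyhedron m hij hj

theorem w_mem_PIII (m : ℕ) {i j : Fin (2 * m + 6)} (hij : (i : ℕ) < j) (hj : (j : ℕ) ≤ 2) :
    w m i j ∈ PIII m :=
  subset_convexHull ℝ _ (Or.inr ⟨i, j, hij, hj, rfl⟩)

theorem hypersimplexOn_subset_PIII (m : ℕ) :
    hypersimplexOn (univ.filter fun i : Fin (2 * m + 6) => 3 ≤ (i : ℕ)) (m + 1) ⊆ PIII m := by
  refine (hypersimplexOn_subset_convexHull _ _).trans (convexHull_mono ?_)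
  rintro x ⟨S, hST, hS, rfl⟩
  refine Or.inl ⟨S, hS, fun s hs => (mem_filter.1 (hST hs)).2, ?_⟩
  ext k
  rw [vS_apply]

/-- A point of the `t`-dilated hypersimplex on the last coordinates is `t` times a point of
`P_III^(m)`. -/
theorem exists_eq_smul_of_dilated (m : ℕ) {t : ℝ} {γ : Fin (2 * m + 6) → ℝ}
    (hlow : ∀ k : Fin (2 * m + 6), (k : ℕ) ≤ 2 → γ k = 0)
    (hhigh : ∀ k : Fin (2 * m + 6), 3 ≤ (k : ℕ) → 0 ≤ γ k ∧ γ k ≤ t)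
    (ht : 0 ≤ t) (hsum : ∑ k, γ k = t * (m + 1)) : ∃ y ∈ PIII m, γ = t • y := by
  have hall : ∀ k, 0 ≤ γ k ∧ γ k ≤ t := fun k => by
    rcases Nat.lt_or_ge (k : ℕ) 3 with hk | hk
    · rw [hlow k (by omega)]
      exact ⟨le_rfl, ht⟩
    · exact hhigh k hk
  rcases ht.eq_or_lt with rfl | htpos
  · refine ⟨w m 0 1, w_mem_PIII m ?_ ?_, ?_⟩
    · simp
    · simp
    · ext k
      simpa using le_antisymm (hall k).2 (hall k).1
  · refine ⟨t⁻¹ • γ, hypersimplexOn_subset_PIII m ⟨fun k => ?_, fun k hk => ?_, ?_⟩, ?_⟩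
    · simp only [Pi.smul_apply, smul_eq_mul]
      exact ⟨mul_nonneg (inv_nonneg.2 ht) (hall k).1, (inv_mul_le_one₀ htpos).2 (hall k).2⟩
    · simp only [mem_filter, mem_univ, true_and, not_le] at hk
      simp [hlow k (by omega)]
    · simp only [Pi.smul_apply, smul_eq_mul, ← mul_sum, hsum]
      push_cast
      field_simp
    · rw [smul_inv_smul₀ htpos.ne']

theorem PIIIPolyhedron_subset_PIII (m : ℕ) : PIIIPolyhedron m ⊆ PIII m := by
  rintro α ⟨hsum, hpair, hlo, hhi⟩
  obtain ⟨h01, h02, h12⟩ := fin_distinct m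
  have v0 : ((0 : Fin (2 * m + 6)) : ℕ) = 0 := rfl
  have v1 := val_one_eq m
  have v2 := val_two m
  have p01 := hpair 0 1 (by omega) (by omega)
  have p02 := hpair 0 2 (by omega) (by omega)
  have p12 := hpair 1 2 (by omega) (by omega)
  set t : ℝ := 1 + 2 * (α 0 + α 1 + α 2) with ht
  set γ : Fin (2 * m + 6) → ℝ := fun k => α k + (α 0 + α 1) * w m 0 1 k +
    (α 0 + α 2) * w m 0 2 k + (α 1 + α 2) * w m 1 2 k with hγ
  have hhigh : ∀ k : Fin (2 * m + 6), 3 ≤ (k : ℕ) → 0 ≤ γ k ∧ γ k ≤ t := fun k hk => by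
    have := hlo k hk
    have := hhi k hk
    simp only [hγ, w_apply_of_three_le m (i := 0) (j := 1) (k := k) (by omega) (by omega) hk,
      w_apply_of_three_le m (i := 0) (j := 2) (k := k) (by omega) (by omega) hk,
      w_apply_of_three_le m (i := 1) (j := 2) (k := k) (by omega) (by omega) hk]
    constructor <;> linarith
  have hlow : ∀ k : Fin (2 * m + 6), (k : ℕ) ≤ 2 → γ k = 0 := fun k hk => by
    have hk' : k = 0 ∨ k = 1 ∨ k = 2 := by
      simp only [Fin.ext_iff, v0, v1, v2]
      omega
    rcases hk' with rfl | rfl | rfl <;>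
      simp only [hγ, w_apply, h01, h02, h12, h01.symm, h02.symm, h12.symm, if_true, if_false] <;>
      ring
  have htpos : 0 ≤ t := by
    have := hhigh ⟨3, by omega⟩ le_rfl
    linarith
  have hγsum : ∑ k, γ k = t * (m + 1) := by
    simp only [hγ, sum_add_distrib, ← mul_sum, sum_w, hsum]
    ring
  obtain ⟨y, hy, hγy⟩ := exists_eq_smul_of_dilated m hlow hhigh htpos hγsum
  have hmem := (convex_convexHull ℝ _ : Convex ℝ (PIII m)).sum_mem (t := univ)
    (w := ![-(α 0 + α 1), -(α 0 + α 2), -(α 1 + α 2), t])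
    (z := ![w m 0 1, w m 0 2, w m 1 2, y])
    (by intro i _; fin_cases i <;> simp <;> linarith)
    (by simp [Fin.sum_univ_four, ht]; ring)
    (by
      intro i _
      fin_cases i
      · exact w_mem_PIII m (by omega) (by omega)
      · exact w_mem_PIII m (by omega) (by omega)
      · exact w_mem_PIII m (by omega) (by omega)
      · exact hy)
  refine (congrArg (· ∈ PIII m) ?_).mpr hmem
  ext k
  have hk := congrFun hγy k
  simp only [hγ, Pi.smul_apply, smul_eq_mul] at hk
  simp only [Fin.sum_univ_four, Matrix.cons_val, Pi.add_apply, Pi.smul_apply, smul_eq_mul]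
  linarith

theorem statement6 (m : ℕ) :
    PIII m =
      {α : Fin (2 * m + 6) → ℝ |
        (∑ i, α i) = (m : ℝ) + 1 ∧
        (∀ i j : Fin (2 * m + 6), (i : ℕ) < (j : ℕ) → (j : ℕ) ≤ 2 → α i + α j ≤ 0) ∧
        (∀ i : Fin (2 * m + 6), 3 ≤ (i : ℕ) → -α i ≤ α 0 + α 1 + α 2) ∧
        (∀ i : Fin (2 * m + 6), 3 ≤ (i : ℕ) → α i - 1 ≤ α 0 + α 1 + α 2)} := by
  exact (PIII_subset_PIIIPolyhedron m).antisymm (PIIIPolyhedron_subset_PIII m)
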